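/- arXiv:2109.08398 — 3 statements merged into one kernel-verified Lean document; each statement's English description precedes it below -/
import Mathlib

section
/- Let k > 0, assume that every vertex of G is incident with at least one edge and that G has at least 16k edges. (i) If τ is a tangle of S_{8k}(E), then τ'' := (τ_X ∩ S_{4k}(X))_E ∩ S_k(E) is a subset of τ. (ii) If τ' is a tangle of S_{8k}(X), then τ''' := (τ'_E ∩ S_{2k}(E))_X ∩ S_k(X) is a subset of τ'. -/
open Finset

namespace BipSep

variable {X Y : Type*} [Fintype X] [Fintype Y] [DecidableEq X] [DecidableEq Y]

/-- `|N(y) ∩ A|`: the number of neighbours of `y` in `A ⊆ X`, where the bipartite graph is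
given by the adjacency relation `R : X → Y → Prop`. -/
def nX (R : X → Y → Prop) [∀ x y, Decidable (R x y)] (y : Y) (A : Finset X) : ℕ :=
  (A.filter fun x => R x y).card

/-- `|N(x) ∩ C|` for `C ⊆ Y`. -/
def nY (R : X → Y → Prop) [∀ x y, Decidable (R x y)] (x : X) (C : Finset Y) : ℕ :=
  (C.filter fun y => R x y).card

/-- The order `|A,B|_X` of a separation `(A,B)` of `X`. -/
def ordX (R : X → Y → Prop) [∀ x y, Decidable (R x y)] (A B : Finset X) : ℚ :=
  ∑ y : Y, ((min (nX R y A) (nX R y B) : ℚ) - (nX R y (A ∩ B) : ℚ) / 2)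

/-- The order `|C,D|_Y` of a separation `(C,D)` of `Y`. -/
def ordY (R : X → Y → Prop) [∀ x y, Decidable (R x y)] (C D : Finset Y) : ℚ :=
  ∑ x : X, ((min (nY R x C) (nY R x D) : ℚ) - (nY R x (C ∩ D) : ℚ) / 2)

/-- `A^▷_B := {y ∈ Y : |N(y) ∩ A| ≥ |N(y) ∩ B|}`. -/
def shiftR1 (R : X → Y → Prop) [∀ x y, Decidable (R x y)] (A B : Finset X) : Finset Y :=
  univ.filter fun y => nX R y B ≤ nX R y A

/-- `B^▷_A := {y ∈ Y : |N(y) ∩ A| ≤ |N(y) ∩ B|}`. -/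
def shiftR2 (R : X → Y → Prop) [∀ x y, Decidable (R x y)] (A B : Finset X) : Finset Y :=
  univ.filter fun y => nX R y A ≤ nX R y B

/-- `C^◁_D := {x ∈ X : |N(x) ∩ C| ≥ |N(x) ∩ D|}`. -/
def shiftL1 (R : X → Y → Prop) [∀ x y, Decidable (R x y)] (C D : Finset Y) : Finset X :=
  univ.filter fun x => nY R x D ≤ nY R x C

/-- `D^◁_C := {x ∈ X : |N(x) ∩ C| ≤ |N(x) ∩ D|}`. -/
def shiftL2 (R : X → Y → Prop) [∀ x y, Decidable (R x y)] (C D : Finset Y) : Finset X :=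
  univ.filter fun x => nY R x C ≤ nY R x D

instance (R : X → Y → Prop) [∀ x y, Decidable (R x y)] :
    DecidablePred fun p : X × Y => R p.1 p.2 :=
  fun p => inferInstanceAs (Decidable (R p.1 p.2))

/-- The edge set of the bipartite graph with adjacency relation `R`: an edge is a pair
`(x,y)` with `x ∈ X`, `y ∈ Y` and `x` adjacent to `y`. -/
abbrev Edge (R : X → Y → Prop) := {p : X × Y // R p.1 p.2}

/-- `|E(x) ∩ C|` for a set `C` of edges. -/
def eX (R : X → Y → Prop) [∀ x y, Decidable (R x y)] (x : X) (C : Finset (Edge R)) : ℕ :=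
  (C.filter fun e => e.1.1 = x).card

/-- `|E(y) ∩ C|` for a set `C` of edges. -/
def eY (R : X → Y → Prop) [∀ x y, Decidable (R x y)] (y : Y) (C : Finset (Edge R)) : ℕ :=
  (C.filter fun e => e.1.2 = y).card

/-- The order `|C,D|_E` of a separation `(C,D)` of the edge set `E`. -/
def ordE (R : X → Y → Prop) [∀ x y, Decidable (R x y)] (C D : Finset (Edge R)) : ℚ :=
  (∑ x : X, ((min (eX R x C) (eX R x D) : ℚ) - (eX R x (C ∩ D) : ℚ) / 2)) +
    ∑ y : Y, ((min (eY R y C) (eY R y D) : ℚ) - (eY R y (C ∩ D) : ℚ) / 2)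

/-- `C^◀_D := {x ∈ X : |E(x) ∩ C| ≥ |E(x) ∩ D|}`. -/
def bshift1 (R : X → Y → Prop) [∀ x y, Decidable (R x y)] (C D : Finset (Edge R)) : Finset X :=
  univ.filter fun x => eX R x D ≤ eX R x C

/-- `D^◀_C := {x ∈ X : |E(x) ∩ C| ≤ |E(x) ∩ D|}`. -/
def bshift2 (R : X → Y → Prop) [∀ x y, Decidable (R x y)] (C D : Finset (Edge R)) : Finset X :=
  univ.filter fun x => eX R x C ≤ eX R x D

/-- `E(A)`: the set of edges with an endpoint in `A ⊆ X`. -/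
def edgesOf (R : X → Y → Prop) [∀ x y, Decidable (R x y)] (A : Finset X) : Finset (Edge R) :=
  univ.filter fun e => e.1.1 ∈ A

/-- `|E(S,T)|`: the number of edges with `X`-endpoint in `T` and `Y`-endpoint in `S`. -/
def eCount (R : X → Y → Prop) [∀ x y, Decidable (R x y)] (T : Finset X) (S : Finset Y) : ℕ :=
  (univ.filter fun e : Edge R => e.1.1 ∈ T ∧ e.1.2 ∈ S).card

/-- `S_k`: the set of oriented separations of order `< k`, with respect to the
order function `ord`. -/
def Sk {V : Type*} [Fintype V] [DecidableEq V] (ord : Finset V → Finset V → ℚ) (k : ℚ) :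
    Set (Finset V × Finset V) :=
  {p | p.1 ∪ p.2 = univ ∧ ord p.1 p.2 < k}

/-- A tangle of `S_k`: a set of oriented separations, all of order `< k`, containing exactly
one of `(A,B)`, `(B,A)` for every separation of order `< k`, such that no three of its
members have their left-hand sides covering the whole ground set. -/
def IsTangle {V : Type*} [Fintype V] [DecidableEq V] (ord : Finset V → Finset V → ℚ)
    (k : ℚ) (τ : Set (Finset V × Finset V)) : Prop :=
  (∀ p ∈ τ, p.1 ∪ p.2 = univ ∧ ord p.1 p.2 < k) ∧
  (∀ A B : Finset V, A ∪ B = univ → ord A B < k → ((A, B) ∈ τ ↔ (B, A) ∉ τ)) ∧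
  ∀ p₁ ∈ τ, ∀ p₂ ∈ τ, ∀ p₃ ∈ τ, p₁.1 ∪ p₂.1 ∪ p₃.1 ≠ univ

/-- A profile of `S_k`: an orientation of `S_k` that is consistent and closed under
the profile property. -/
def IsProfile {V : Type*} [Fintype V] [DecidableEq V] (ord : Finset V → Finset V → ℚ)
    (k : ℚ) (P : Set (Finset V × Finset V)) : Prop :=
  (∀ p ∈ P, p.1 ∪ p.2 = univ ∧ ord p.1 p.2 < k) ∧
  (∀ A B : Finset V, A ∪ B = univ → ord A B < k → ((A, B) ∈ P ↔ (B, A) ∉ P)) ∧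
  (∀ A₁ B₁ A₂ B₂ : Finset V, A₁ ⊆ A₂ → B₂ ⊆ B₁ →
    ¬((A₁ = A₂ ∧ B₁ = B₂) ∨ (A₁ = B₂ ∧ B₁ = A₂)) →
    ¬((B₁, A₁) ∈ P ∧ (A₂, B₂) ∈ P)) ∧
  ∀ p₁ ∈ P, ∀ p₂ ∈ P, (p₁.2 ∩ p₂.2, p₁.1 ∪ p₂.1) ∉ P

/-- A regular profile: a profile containing no separation of the form `(V,B)`. -/
def IsRegularProfile {V : Type*} [Fintype V] [DecidableEq V] (ord : Finset V → Finset V → ℚ)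
    (k : ℚ) (P : Set (Finset V × Finset V)) : Prop :=
  IsProfile ord k P ∧ ∀ B : Finset V, (univ, B) ∉ P

/-- `^▷τ`: the separations `(C,D)` of `Y` whose shift `(C,D)^◁` lies in `τ`. -/
def pullY (R : X → Y → Prop) [∀ x y, Decidable (R x y)] (τ : Set (Finset X × Finset X)) :
    Set (Finset Y × Finset Y) :=
  {q | q.1 ∪ q.2 = univ ∧ (shiftL1 R q.1 q.2, shiftL2 R q.1 q.2) ∈ τ}

/-- `^◁τ`: the separations `(A,B)` of `X` whose shift `(A,B)^▷` lies in `τ`. -/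
def pullX (R : X → Y → Prop) [∀ x y, Decidable (R x y)] (τ : Set (Finset Y × Finset Y)) :
    Set (Finset X × Finset X) :=
  {p | p.1 ∪ p.2 = univ ∧ (shiftR1 R p.1 p.2, shiftR2 R p.1 p.2) ∈ τ}

/-- `τ_E`: the separations `(C,D)` of `E` whose shift `(C,D)^◀` lies in `τ`. -/
def pullE (R : X → Y → Prop) [∀ x y, Decidable (R x y)] (τ : Set (Finset X × Finset X)) :
    Set (Finset (Edge R) × Finset (Edge R)) :=
  {q | q.1 ∪ q.2 = univ ∧ (bshift1 R q.1 q.2, bshift2 R q.1 q.2) ∈ τ}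

/-- `τ_X := {(C,D)^◀ : (C,D) ∈ τ}`. -/
def pushX (R : X → Y → Prop) [∀ x y, Decidable (R x y)]
    (τ : Set (Finset (Edge R) × Finset (Edge R))) : Set (Finset X × Finset X) :=
  {p | ∃ q ∈ τ, (bshift1 R q.1 q.2, bshift2 R q.1 q.2) = p}


theorem edgeOrder_term_nonneg {a b c : ℕ} (ha : c ≤ a) (hb : c ≤ b) :
    (0 : ℚ) ≤ (min a b : ℚ) - (c : ℚ) / 2 := by
  have ha' : (c : ℚ) ≤ a := mod_cast ha
  have hb' : (c : ℚ) ≤ b := mod_cast hb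
  have hc : (0 : ℚ) ≤ c := Nat.cast_nonneg c
  have : (c : ℚ) ≤ min (a : ℚ) b := le_min ha' hb'
  linarith

omit [Fintype X] [Fintype Y] [DecidableEq Y] in
theorem eX_mono (R : X → Y → Prop) [∀ x y, Decidable (R x y)] (x : X)
    {C D : Finset (Edge R)} (h : C ⊆ D) : eX R x C ≤ eX R x D :=
  card_le_card (filter_subset_filter _ h)

omit [Fintype X] [Fintype Y] [DecidableEq X] in
theorem eY_mono (R : X → Y → Prop) [∀ x y, Decidable (R x y)] (y : Y)
    {C D : Finset (Edge R)} (h : C ⊆ D) : eY R y C ≤ eY R y D :=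
  card_le_card (filter_subset_filter _ h)

omit [Fintype X] [Fintype Y] in
theorem eX_union_add_eX_inter (R : X → Y → Prop) [∀ x y, Decidable (R x y)] (x : X)
    (C D : Finset (Edge R)) :
    eX R x (C ∪ D) + eX R x (C ∩ D) = eX R x C + eX R x D := by
  unfold eX
  rw [filter_union, filter_inter_distrib, card_union_add_card_inter]

omit [Fintype Y] [DecidableEq Y] in
theorem sum_eX (R : X → Y → Prop) [∀ x y, Decidable (R x y)] (C : Finset (Edge R)) :
    ∑ x : X, eX R x C = C.card :=
  (card_eq_sum_card_fiberwise fun _ _ => mem_coe.2 (mem_univ _)).symm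

omit [Fintype X] [DecidableEq X] in
theorem sum_eY (R : X → Y → Prop) [∀ x y, Decidable (R x y)] (C : Finset (Edge R)) :
    ∑ y : Y, eY R y C = C.card :=
  (card_eq_sum_card_fiberwise fun _ _ => mem_coe.2 (mem_univ _)).symm

theorem ordE_comm (R : X → Y → Prop) [∀ x y, Decidable (R x y)] (C D : Finset (Edge R)) :
    ordE R C D = ordE R D C := by
  simp only [ordE, min_comm, inter_comm]

/-- The part of the order of a separation of `E` contributed by the vertices in `X`. -/
def ordEX (R : X → Y → Prop) [∀ x y, Decidable (R x y)] (C D : Finset (Edge R)) : ℚ :=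
  ∑ x : X, ((min (eX R x C) (eX R x D) : ℚ) - (eX R x (C ∩ D) : ℚ) / 2)

theorem ordEX_le_ordE (R : X → Y → Prop) [∀ x y, Decidable (R x y)]
    (C D : Finset (Edge R)) : ordEX R C D ≤ ordE R C D :=
  le_add_of_nonneg_right <| sum_nonneg fun y _ =>
    edgeOrder_term_nonneg (eY_mono R y inter_subset_left) (eY_mono R y inter_subset_right)

theorem ordE_univ_right (R : X → Y → Prop) [∀ x y, Decidable (R x y)]
    (F : Finset (Edge R)) : ordE R F univ = F.card := by
  have hX (x : X) : min (eX R x F : ℚ) (eX R x univ) = eX R x F :=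
    min_eq_left (mod_cast eX_mono R x (subset_univ F))
  have hY (y : Y) : min (eY R y F : ℚ) (eY R y univ) = eY R y F :=
    min_eq_left (mod_cast eY_mono R y (subset_univ F))
  simp only [ordE, hX, hY, inter_univ, sub_half, ← sum_div]
  rw [← Nat.cast_sum, ← Nat.cast_sum, sum_eX, sum_eY, add_halves]

omit [DecidableEq Y] in
theorem eX_edgesOf_of_mem (R : X → Y → Prop) [∀ x y, Decidable (R x y)] {x : X}
    {A : Finset X} (h : x ∈ A) : eX R x (edgesOf R A) = eX R x univ := by
  unfold eX edgesOf
  rw [filter_filter]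
  congr 1
  ext e
  simp only [mem_filter, mem_univ, true_and, and_iff_right_iff_imp]
  rintro rfl
  exact h

omit [DecidableEq Y] in
theorem eX_edgesOf_of_notMem (R : X → Y → Prop) [∀ x y, Decidable (R x y)] {x : X}
    {A : Finset X} (h : x ∉ A) : eX R x (edgesOf R A) = 0 := by
  unfold eX edgesOf
  rw [filter_filter, card_eq_zero, filter_eq_empty_iff]
  rintro e - ⟨he, rfl⟩
  exact h he

theorem eY_edgesOf (R : X → Y → Prop) [∀ x y, Decidable (R x y)] (y : Y)
    (A : Finset X) : eY R y (edgesOf R A) = nX R y A := by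
  unfold eY edgesOf nX
  refine card_bij (fun e _ => e.1.1) ?_ ?_ ?_
  · rintro ⟨⟨x, y'⟩, h⟩ he
    simp only [mem_filter, mem_univ, true_and] at he ⊢
    obtain ⟨hx, rfl⟩ := he
    exact ⟨hx, h⟩
  · rintro ⟨⟨x, y₁⟩, h₁⟩ he₁ ⟨⟨x', y₂⟩, h₂⟩ he₂ h
    simp only [mem_filter, mem_univ, true_and] at he₁ he₂ h
    obtain ⟨-, rfl⟩ := he₁
    obtain ⟨-, rfl⟩ := he₂
    subst h
    rfl
  · intro x hx
    rw [mem_filter] at hx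
    exact ⟨⟨(x, y), hx.2⟩, by simp [hx.1], rfl⟩

theorem edgesOf_inter (R : X → Y → Prop) [∀ x y, Decidable (R x y)] (A B : Finset X) :
    edgesOf R A ∩ edgesOf R B = edgesOf R (A ∩ B) := by
  ext e
  simp [edgesOf]

theorem edgesOf_union_eq_univ (R : X → Y → Prop) [∀ x y, Decidable (R x y)]
    {A B : Finset X} (h : A ∪ B = univ) : edgesOf R A ∪ edgesOf R B = univ := by
  ext e
  have : e.1.1 ∈ A ∪ B := h ▸ mem_univ _
  simpa [edgesOf] using this

omit [Fintype Y] [DecidableEq Y] in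
theorem bshift_union (R : X → Y → Prop) [∀ x y, Decidable (R x y)]
    (C D : Finset (Edge R)) : bshift1 R C D ∪ bshift2 R C D = univ := by
  ext x
  simpa [bshift1, bshift2] using le_total _ _

theorem ordE_edgesOf_bshift_le (R : X → Y → Prop) [∀ x y, Decidable (R x y)]
    {C D : Finset (Edge R)} (h : C ∪ D = univ) :
    ordE R (edgesOf R (bshift1 R C D)) (edgesOf R (bshift2 R C D)) ≤
      ordEX R C D + ordX R (bshift1 R C D) (bshift2 R C D) := by
  unfold ordE
  simp only [edgesOf_inter, eY_edgesOf]
  refine add_le_add (sum_le_sum fun x _ => ?_) le_rfl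
  have hnonneg := edgeOrder_term_nonneg (eX_mono R x (inter_subset_left (s₁ := C) (s₂ := D)))
    (eX_mono R x inter_subset_right)
  by_cases hA : x ∈ bshift1 R C D <;> by_cases hB : x ∈ bshift2 R C D
  · rw [eX_edgesOf_of_mem R hA, eX_edgesOf_of_mem R hB,
      eX_edgesOf_of_mem R (mem_inter.2 ⟨hA, hB⟩), min_self]
    have heq : eX R x C = eX R x D :=
      le_antisymm (mem_filter.1 hB).2 (mem_filter.1 hA).2
    have hsum := eX_union_add_eX_inter R x C D
    rw [h, ← heq] at hsum
    rw [← heq, min_self]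
    have : (eX R x univ : ℚ) + eX R x (C ∩ D) = eX R x C + eX R x C := mod_cast hsum
    linarith
  · rw [eX_edgesOf_of_notMem R hB, eX_edgesOf_of_notMem R fun hx => hB (mem_inter.1 hx).2]
    simpa using hnonneg
  · rw [eX_edgesOf_of_notMem R hA, eX_edgesOf_of_notMem R fun hx => hA (mem_inter.1 hx).1]
    simpa using hnonneg
  · rw [eX_edgesOf_of_notMem R hA, eX_edgesOf_of_notMem R fun hx => hA (mem_inter.1 hx).1]
    simpa using hnonneg

theorem card_compl_sdiff_edgesOf_le (R : X → Y → Prop) [∀ x y, Decidable (R x y)]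
    {C D : Finset (Edge R)} (h : C ∪ D = univ) :
    ((Cᶜ \ edgesOf R (bshift2 R C D)).card : ℚ) ≤ ordEX R C D := by
  rw [← sum_eX, Nat.cast_sum]
  refine sum_le_sum fun x _ => ?_
  set F := Cᶜ \ edgesOf R (bshift2 R C D)
  by_cases hB : x ∈ bshift2 R C D
  · have : eX R x F = 0 := by
      unfold eX
      rw [card_eq_zero, filter_eq_empty_iff]
      rintro e he rfl
      exact (mem_sdiff.1 he).2 (mem_filter.2 ⟨mem_univ _, hB⟩)
    rw [this, Nat.cast_zero]
    exact edgeOrder_term_nonneg (eX_mono R x inter_subset_left) (eX_mono R x inter_subset_right)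
  · have hlt : eX R x D < eX R x C := by simpa [bshift2] using hB
    have hle : eX R x F ≤ eX R x Cᶜ := eX_mono R x sdiff_subset
    have hcompl := eX_union_add_eX_inter R x C Cᶜ
    have hsum := eX_union_add_eX_inter R x C D
    rw [union_compl, inter_compl] at hcompl
    rw [h] at hsum
    have hzero : eX R x (∅ : Finset (Edge R)) = 0 := by simp [eX]
    have hnat : eX R x F + eX R x (C ∩ D) ≤ eX R x D := by omega
    have hrat : (eX R x F : ℚ) + eX R x (C ∩ D) ≤ eX R x D := mod_cast hnat
    rw [min_eq_right (by exact_mod_cast hlt.le)]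
    have : (0 : ℚ) ≤ eX R x (C ∩ D) := Nat.cast_nonneg _
    linarith

/-- A tangle of `E` that contains `(C,D)` also contains the separation of `E` induced by the
shift of `(C,D)`, provided this has small enough order. -/
theorem IsTangle.edgesOf_bshift_mem (R : X → Y → Prop) [∀ x y, Decidable (R x y)] {K : ℚ}
    {τ : Set (Finset (Edge R) × Finset (Edge R))} (hτ : IsTangle (ordE R) K τ)
    {C D : Finset (Edge R)} (hCD : (C, D) ∈ τ)
    (hord : ordE R (edgesOf R (bshift1 R C D)) (edgesOf R (bshift2 R C D)) < K) :
    (edgesOf R (bshift1 R C D), edgesOf R (bshift2 R C D)) ∈ τ := by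
  obtain ⟨hmem, horient, hcover⟩ := hτ
  obtain ⟨hun, hlt⟩ := hmem _ hCD
  rw [horient _ _ (edgesOf_union_eq_univ R (bshift_union R C D)) hord]
  intro hBA
  set F := Cᶜ \ edgesOf R (bshift2 R C D)
  have hF : (F, univ) ∈ τ := by
    refine (horient _ _ (by simp) ?_).2 fun hbad => ?_
    · rw [ordE_univ_right]
      exact ((card_compl_sdiff_edgesOf_le R hun).trans (ordEX_le_ordE R C D)).trans_lt hlt
    · exact hcover _ hbad _ hbad _ hbad (by simp)
  refine hcover _ hCD _ hBA _ hF (eq_univ_iff_forall.2 fun e => ?_)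
  simp only [F, mem_union, mem_sdiff, mem_compl]
  tauto

/-- Shifting a tangle from `E` to `X` and back (or from `X` to `E` and back) yields a
restriction of the original tangle. -/
theorem double_shift_edges (R : X → Y → Prop) [∀ x y, Decidable (R x y)] (k : ℚ) (hk : 0 < k)
    (hdegX : ∀ x : X, ∃ y : Y, R x y) (hdegY : ∀ y : Y, ∃ x : X, R x y)
    (hE : 16 * k ≤ (Fintype.card (Edge R) : ℚ)) :
    (∀ τ : Set (Finset (Edge R) × Finset (Edge R)), IsTangle (ordE R) (8 * k) τ →
      pullE R (pushX R τ ∩ Sk (ordX R) (4 * k)) ∩ Sk (ordE R) k ⊆ τ) ∧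
    (∀ τ' : Set (Finset X × Finset X), IsTangle (ordX R) (8 * k) τ' →
      pushX R (pullE R τ' ∩ Sk (ordE R) (2 * k)) ∩ Sk (ordX R) k ⊆ τ') := by
  refine ⟨fun τ hτ => ?_, ?_⟩
  · rintro ⟨C, D⟩ ⟨⟨hun, ⟨⟨C', D'⟩, hC', hshift⟩, -, hX⟩, -, hlt⟩
    obtain ⟨h₁, h₂⟩ := Prod.mk.inj hshift
    simp only at hun hX hlt h₁ h₂
    have hord : ordE R (edgesOf R (bshift1 R C D)) (edgesOf R (bshift2 R C D)) < 8 * k := by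
      linarith [ordE_edgesOf_bshift_le R hun, ordEX_le_ordE R C D]
    refine (hτ.2.1 C D hun (by linarith)).2 fun hDC => ?_
    have hAB := hτ.edgesOf_bshift_mem R hC' (by rwa [h₁, h₂])
    rw [h₁, h₂] at hAB
    exact (hτ.2.1 _ _ (edgesOf_union_eq_univ R (bshift_union R C D)) hord).1 hAB
      (hτ.edgesOf_bshift_mem R hDC (by rw [ordE_comm]; exact hord))
  · rintro τ' - _ ⟨⟨q, ⟨⟨-, hq⟩, -⟩, rfl⟩, -⟩
    exact hq

end BipSep
end

section
/- Let k > 0, assume that every vertex of G is incident with at least one edge and that G has at least 16k edges. If τ is a tangle of S_{8k}(X), then τ' := ^▷τ ∩ S_k(Y) is a tangle of S_k(Y). -/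
open Finset

namespace BipSep

variable {X Y : Type*} [Fintype X] [Fintype Y] [DecidableEq X] [DecidableEq Y]

set_option linter.unusedSectionVars false

/-- The signed indicator of a separation `(C, D)`: `1` on `C \ D`, `-1` on `D \ C`, and `0` on
`C ∩ D`. -/
def sg {V : Type*} [DecidableEq V] (C D : Finset V) (v : V) : ℚ :=
  (if v ∈ C then 1 else 0) - (if v ∈ D then 1 else 0)

lemma union_union_inter_eq_univ {V : Type*} [Fintype V] [DecidableEq V] {A₁ B₁ A₂ B₂ : Finset V}
    (h₁ : A₁ ∪ B₁ = univ) (h₂ : A₂ ∪ B₂ = univ) : A₁ ∪ A₂ ∪ B₁ ∩ B₂ = univ := by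
  grind

/-- Half the number of edges, counted with the weight by which the separations `(A, B)` of `X`
and `(C, D)` of `Y` disagree on them. -/
def disagreement (R : X → Y → Prop) [∀ x y, Decidable (R x y)] (A B : Finset X)
    (C D : Finset Y) : ℚ :=
  (∑ x : X, ∑ y : Y, if R x y then 1 - sg A B x * sg C D y else 0) / 2

lemma abs_sg_le_one {V : Type*} [DecidableEq V] (C D : Finset V) (v : V) : |sg C D v| ≤ 1 := by
  unfold sg
  split_ifs <;> norm_num

lemma sg_mul_sg_le_one {V W : Type*} [DecidableEq V] [DecidableEq W] (A B : Finset V)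
    (C D : Finset W) (v : V) (w : W) : sg A B v * sg C D w ≤ 1 := by
  refine (le_abs_self _).trans ?_
  rw [abs_mul]
  exact mul_le_one₀ (abs_sg_le_one A B v) (abs_nonneg _) (abs_sg_le_one C D w)

lemma nY_mono (R : X → Y → Prop) [∀ x y, Decidable (R x y)] (x : X) {C D : Finset Y}
    (h : C ⊆ D) : nY R x C ≤ nY R x D :=
  card_le_card (filter_subset_filter _ h)

lemma nY_union_add_inter (R : X → Y → Prop) [∀ x y, Decidable (R x y)] (x : X)
    (C D : Finset Y) : (nY R x (C ∪ D) : ℚ) + nY R x (C ∩ D) = nY R x C + nY R x D := by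
  unfold nY
  rw [filter_union, filter_inter_distrib]
  exact_mod_cast card_union_add_card_inter _ _

lemma nY_eq_sum (R : X → Y → Prop) [∀ x y, Decidable (R x y)] (x : X) (C : Finset Y) :
    (nY R x C : ℚ) = ∑ y : Y, if R x y then (if y ∈ C then 1 else 0) else 0 := by
  simp only [nY, card_filter, Nat.cast_sum, Nat.cast_ite, Nat.cast_one, Nat.cast_zero]
  rw [← sum_filter_add_sum_filter_not univ (fun y => y ∈ C)]
  rw [sum_eq_zero (s := univ.filter fun y => ¬ y ∈ C), add_zero]
  · rw [filter_univ_mem]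
    exact sum_congr rfl fun y hy => by simp [hy]
  · intro y hy
    simp [(mem_filter.1 hy).2]

lemma nY_sub_nY_eq_sum (R : X → Y → Prop) [∀ x y, Decidable (R x y)] (x : X) (C D : Finset Y) :
    (nY R x C : ℚ) - nY R x D = ∑ y : Y, if R x y then sg C D y else 0 := by
  rw [nY_eq_sum, nY_eq_sum, ← sum_sub_distrib]
  refine sum_congr rfl fun y _ => ?_
  unfold sg
  split_ifs <;> simp

lemma ordY_eq_sum_abs (R : X → Y → Prop) [∀ x y, Decidable (R x y)] {C D : Finset Y}
    (h : C ∪ D = univ) :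
    ordY R C D = ∑ x : X, ((nY R x univ : ℚ) - |(nY R x C : ℚ) - nY R x D|) / 2 := by
  refine sum_congr rfl fun x _ => ?_
  have := nY_union_add_inter R x C D
  rw [h] at this
  rcases le_total (nY R x C : ℚ) (nY R x D) with h' | h'
  · rw [min_eq_left h', abs_of_nonpos (by linarith)]
    linarith
  · rw [min_eq_right h', abs_of_nonneg (by linarith)]
    linarith

lemma ordY_nonneg (R : X → Y → Prop) [∀ x y, Decidable (R x y)] (C D : Finset Y) :
    0 ≤ ordY R C D := by
  refine sum_nonneg fun x _ => ?_
  have h₁ : (nY R x (C ∩ D) : ℚ) ≤ min (nY R x C : ℚ) (nY R x D) :=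
    le_min (by exact_mod_cast nY_mono R x inter_subset_left)
      (by exact_mod_cast nY_mono R x inter_subset_right)
  have h₂ : (0 : ℚ) ≤ nY R x (C ∩ D) := Nat.cast_nonneg _
  linarith

lemma ordY_comm (R : X → Y → Prop) [∀ x y, Decidable (R x y)] (C D : Finset Y) :
    ordY R C D = ordY R D C := by
  simp only [ordY, min_comm, inter_comm]

/-- The order of separations is submodular. -/
lemma ordY_union_inter_le (R : X → Y → Prop) [∀ x y, Decidable (R x y)]
    {C₁ D₁ C₂ D₂ : Finset Y} (h₁ : C₁ ∪ D₁ = univ) (h₂ : C₂ ∪ D₂ = univ) :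
    ordY R (C₁ ∪ C₂) (D₁ ∩ D₂) + ordY R (C₁ ∩ C₂) (D₁ ∪ D₂) ≤ ordY R C₁ D₁ + ordY R C₂ D₂ := by
  have h₃ := union_union_inter_eq_univ h₁ h₂
  have h₄ : (C₁ ∩ C₂) ∪ (D₁ ∪ D₂) = univ := by grind
  rw [ordY_eq_sum_abs R h₁, ordY_eq_sum_abs R h₂, ordY_eq_sum_abs R h₃, ordY_eq_sum_abs R h₄,
    ← sum_add_distrib, ← sum_add_distrib]
  refine sum_le_sum fun x _ => ?_
  have hC := nY_union_add_inter R x C₁ C₂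
  have hD := nY_union_add_inter R x D₁ D₂
  have mono {S T : Finset Y} (h : S ⊆ T) : (nY R x S : ℚ) ≤ nY R x T := by
    exact_mod_cast nY_mono R x h
  have c₁ := mono (subset_union_left : C₁ ⊆ C₁ ∪ C₂)
  have c₂ := mono (subset_union_right : C₂ ⊆ C₁ ∪ C₂)
  have d₁ := mono (inter_subset_left : D₁ ∩ D₂ ⊆ D₁)
  have d₂ := mono (inter_subset_right : D₁ ∩ D₂ ⊆ D₂)
  have key : |(nY R x C₁ : ℚ) - nY R x D₁| + |(nY R x C₂ : ℚ) - nY R x D₂| ≤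
      |(nY R x (C₁ ∪ C₂) : ℚ) - nY R x (D₁ ∩ D₂)| +
        |(nY R x (C₁ ∩ C₂) : ℚ) - nY R x (D₁ ∪ D₂)| := by
    rcases abs_cases ((nY R x (C₁ ∪ C₂) : ℚ) - nY R x (D₁ ∩ D₂)) with e₁ | e₁ <;>
    rcases abs_cases ((nY R x (C₁ ∩ C₂) : ℚ) - nY R x (D₁ ∪ D₂)) with e₂ | e₂ <;>
    rcases abs_cases ((nY R x C₁ : ℚ) - nY R x D₁) with e₃ | e₃ <;>
    rcases abs_cases ((nY R x C₂ : ℚ) - nY R x D₂) with e₄ | e₄ <;>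
    linarith
  linarith

lemma disagreement_eq_sum (R : X → Y → Prop) [∀ x y, Decidable (R x y)] (A B : Finset X)
    (C D : Finset Y) :
    disagreement R A B C D =
      ∑ x : X, ((nY R x univ : ℚ) - sg A B x * ((nY R x C : ℚ) - nY R x D)) / 2 := by
  rw [disagreement, sum_div]
  refine sum_congr rfl fun x _ => ?_
  rw [nY_sub_nY_eq_sum, nY_eq_sum, mul_sum, ← sum_sub_distrib]
  congr 1
  refine sum_congr rfl fun y _ => ?_
  split_ifs <;> simp_all

lemma ordY_le_disagreement (R : X → Y → Prop) [∀ x y, Decidable (R x y)] (A B : Finset X)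
    {C D : Finset Y} (h : C ∪ D = univ) : ordY R C D ≤ disagreement R A B C D := by
  rw [ordY_eq_sum_abs R h, disagreement_eq_sum]
  refine sum_le_sum fun x _ => ?_
  have : sg A B x * ((nY R x C : ℚ) - nY R x D) ≤ |(nY R x C : ℚ) - nY R x D| := by
    refine (le_abs_self _).trans ?_
    rw [abs_mul]
    exact mul_le_of_le_one_left (abs_nonneg _) (abs_sg_le_one A B x)
  linarith

lemma ordY_eq_disagreement_shift (R : X → Y → Prop) [∀ x y, Decidable (R x y)]
    {C D : Finset Y} (h : C ∪ D = univ) :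
    ordY R C D = disagreement R (shiftL1 R C D) (shiftL2 R C D) C D := by
  rw [ordY_eq_sum_abs R h, disagreement_eq_sum]
  refine sum_congr rfl fun x _ => ?_
  congr 2
  simp only [sg, shiftL1, shiftL2, mem_filter, mem_univ, true_and]
  rcases lt_trichotomy (nY R x C) (nY R x D) with h' | h' | h'
  · have : (nY R x C : ℚ) < nY R x D := by exact_mod_cast h'
    rw [if_neg h'.not_ge, if_pos h'.le, abs_of_neg (by linarith)]
    ring
  · simp [h']
  · have : (nY R x D : ℚ) < nY R x C := by exact_mod_cast h'
    rw [if_pos h'.le, if_neg h'.not_ge, abs_of_pos (by linarith)]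
    ring

lemma disagreement_flip (R : X → Y → Prop) [∀ x y, Decidable (R x y)] (A B : Finset X)
    (C D : Finset Y) :
    disagreement (fun y x => R x y) C D A B = disagreement R A B C D := by
  unfold disagreement
  rw [sum_comm]
  simp only [mul_comm]

lemma ordX_le_disagreement (R : X → Y → Prop) [∀ x y, Decidable (R x y)] {A B : Finset X}
    (C D : Finset Y) (h : A ∪ B = univ) : ordX R A B ≤ disagreement R A B C D := by
  rw [← disagreement_flip]
  exact ordY_le_disagreement (fun y x => R x y) C D h

lemma shiftL1_union_shiftL2 (R : X → Y → Prop) [∀ x y, Decidable (R x y)] (C D : Finset Y) :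
    shiftL1 R C D ∪ shiftL2 R C D = univ := by
  ext x
  simpa [shiftL1, shiftL2] using le_total _ _

/-- Shifting a separation does not increase its order. -/
lemma ordX_shift_le (R : X → Y → Prop) [∀ x y, Decidable (R x y)] {C D : Finset Y}
    (h : C ∪ D = univ) : ordX R (shiftL1 R C D) (shiftL2 R C D) ≤ ordY R C D := by
  rw [ordY_eq_disagreement_shift R h]
  exact ordX_le_disagreement R C D (shiftL1_union_shiftL2 R C D)

lemma ordX_union_inter_le (R : X → Y → Prop) [∀ x y, Decidable (R x y)]
    {A₁ B₁ A₂ B₂ : Finset X} (h₁ : A₁ ∪ B₁ = univ) (h₂ : A₂ ∪ B₂ = univ) :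
    ordX R (A₁ ∪ A₂) (B₁ ∩ B₂) ≤ ordX R A₁ B₁ + ordX R A₂ B₂ := by
  have h := ordY_union_inter_le (fun y x => R x y) h₁ h₂
  have h' := ordY_nonneg (fun y x => R x y) (A₁ ∩ A₂) (B₁ ∪ B₂)
  change ordY (fun y x => R x y) _ _ ≤ ordY (fun y x => R x y) _ _ + ordY (fun y x => R x y) _ _
  linarith

lemma ordX_univ_right (R : X → Y → Prop) [∀ x y, Decidable (R x y)] (Z : Finset X) :
    ordX R Z univ = (∑ x : X, ∑ y : Y, if R x y then (if x ∈ Z then (1 : ℚ) else 0) else 0) / 2 := by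
  rw [sum_comm, sum_div]
  refine sum_congr rfl fun y _ => ?_
  have h : (nX R y Z : ℚ) ≤ nX R y univ := by
    exact_mod_cast nY_mono (fun y x => R x y) y (subset_univ Z)
  have h' := nY_eq_sum (fun y x => R x y) y Z
  rw [min_eq_left h, inter_univ, ← h']
  change (nX R y Z : ℚ) - nX R y Z / 2 = nX R y Z / 2
  ring

lemma one_le_one_sub_sg_mul_sg {V W : Type*} [Fintype V] [DecidableEq V] [DecidableEq W]
    {A B : Finset V} {C D : Finset W} {v : V} {w : W} (h : A ∪ B = univ) (hv : v ∉ A)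
    (hw : w ∈ C) : 1 ≤ 1 - sg A B v * sg C D w := by
  have hB : v ∈ B := (mem_union.1 (h ▸ mem_univ v)).resolve_left hv
  simp only [sg, if_neg hv, if_pos hB, if_pos hw]
  split_ifs <;> norm_num

/-- If the left-hand sides of three separations of `Y` cover `Y`, then few edges are incident
with the vertices missed by the left-hand sides of their shifts. -/
lemma ordX_compl_shift_le (R : X → Y → Prop) [∀ x y, Decidable (R x y)]
    {C₁ D₁ C₂ D₂ C₃ D₃ : Finset Y} (h₁ : C₁ ∪ D₁ = univ) (h₂ : C₂ ∪ D₂ = univ)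
    (h₃ : C₃ ∪ D₃ = univ) (hC : C₁ ∪ C₂ ∪ C₃ = univ) :
    ordX R (shiftL1 R C₁ D₁ ∪ shiftL1 R C₂ D₂ ∪ shiftL1 R C₃ D₃)ᶜ univ ≤
      ordY R C₁ D₁ + ordY R C₂ D₂ + ordY R C₃ D₃ := by
  rw [ordY_eq_disagreement_shift R h₁, ordY_eq_disagreement_shift R h₂,
    ordY_eq_disagreement_shift R h₃, ordX_univ_right]
  simp only [disagreement]
  rw [← add_div, ← add_div, ← sum_add_distrib, ← sum_add_distrib]
  refine div_le_div_of_nonneg_right (sum_le_sum fun x _ => ?_) zero_le_two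
  rw [← sum_add_distrib, ← sum_add_distrib]
  refine sum_le_sum fun y _ => ?_
  by_cases hR : R x y
  swap
  · simp [hR]
  simp only [if_pos hR]
  have p₁ := sg_mul_sg_le_one (shiftL1 R C₁ D₁) (shiftL2 R C₁ D₁) C₁ D₁ x y
  have p₂ := sg_mul_sg_le_one (shiftL1 R C₂ D₂) (shiftL2 R C₂ D₂) C₂ D₂ x y
  have p₃ := sg_mul_sg_le_one (shiftL1 R C₃ D₃) (shiftL2 R C₃ D₃) C₃ D₃ x y
  split_ifs with hx
  swap
  · linarith
  simp only [mem_compl, mem_union, not_or] at hx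
  have hy : y ∈ C₁ ∪ C₂ ∪ C₃ := hC ▸ mem_univ y
  simp only [mem_union] at hy
  rcases hy with (hy | hy) | hy
  · have := one_le_one_sub_sg_mul_sg (D := D₁) (shiftL1_union_shiftL2 R C₁ D₁) hx.1.1 hy
    linarith
  · have := one_le_one_sub_sg_mul_sg (D := D₂) (shiftL1_union_shiftL2 R C₂ D₂) hx.1.2 hy
    linarith
  · have := one_le_one_sub_sg_mul_sg (D := D₃) (shiftL1_union_shiftL2 R C₃ D₃) hx.2 hy
    linarith

/-- If `τ` is a tangle of `S_{8k}(X)`, then `^▷τ ∩ S_k(Y)` is a tangle of `S_k(Y)`. -/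
theorem tangle_shift_weaker (R : X → Y → Prop) [∀ x y, Decidable (R x y)] (k : ℚ) (hk : 0 < k)
    (hdegX : ∀ x : X, ∃ y : Y, R x y) (hdegY : ∀ y : Y, ∃ x : X, R x y)
    (hE : 16 * k ≤ (Fintype.card (Edge R) : ℚ))
    (τ : Set (Finset X × Finset X)) (hτ : IsTangle (ordX R) (8 * k) τ) :
    IsTangle (ordY R) k (pullY R τ ∩ Sk (ordY R) k) := by
  obtain ⟨-, horient, hcover⟩ := hτ
  refine ⟨fun p hp => hp.2, ?_, ?_⟩
  · intro C D hCD hord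
    have hDC : D ∪ C = univ := by rw [union_comm, hCD]
    have hord' : ordY R D C < k := by rwa [ordY_comm]
    have hshift : ordX R (shiftL1 R C D) (shiftL2 R C D) < 8 * k := by
      linarith [ordX_shift_le R hCD]
    have h := horient _ _ (shiftL1_union_shiftL2 R C D) hshift
    have h₁ : (C, D) ∈ pullY R τ ∩ Sk (ordY R) k ↔ (shiftL1 R C D, shiftL2 R C D) ∈ τ :=
      ⟨fun hp => hp.1.2, fun hp => ⟨⟨hCD, hp⟩, hCD, hord⟩⟩
    have h₂ : (D, C) ∈ pullY R τ ∩ Sk (ordY R) k ↔ (shiftL2 R C D, shiftL1 R C D) ∈ τ :=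
      ⟨fun hp => hp.1.2, fun hp => ⟨⟨hDC, hp⟩, hDC, hord'⟩⟩
    rw [h₁, h₂, h]
  · rintro ⟨C₁, D₁⟩ ⟨⟨h₁, t₁⟩, -, o₁⟩ ⟨C₂, D₂⟩ ⟨⟨h₂, t₂⟩, -, o₂⟩ ⟨C₃, D₃⟩ ⟨⟨h₃, t₃⟩, -, o₃⟩ hC
    simp only at h₁ h₂ h₃ t₁ t₂ t₃ o₁ o₂ o₃ hC
    have hZord := ordX_compl_shift_le R h₁ h₂ h₃ hC
    have s₁ := shiftL1_union_shiftL2 R C₁ D₁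
    have s₂ := shiftL1_union_shiftL2 R C₂ D₂
    have hUord := ordX_union_inter_le R s₁ s₂
    have i₁ := ordX_shift_le R h₁
    have i₂ := ordX_shift_le R h₂
    generalize shiftL1 R C₁ D₁ = A₁, shiftL2 R C₁ D₁ = B₁, shiftL1 R C₂ D₂ = A₂,
      shiftL2 R C₂ D₂ = B₂, shiftL1 R C₃ D₃ = A₃, shiftL2 R C₃ D₃ = B₃ at *
    have hZ : ((A₁ ∪ A₂ ∪ A₃)ᶜ, univ) ∈ τ := by
      rw [horient _ _ (by simp) (by linarith)]
      intro hX
      exact hcover _ hX _ hX _ hX (by simp)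
    have hU : (A₁ ∪ A₂, B₁ ∩ B₂) ∈ τ := by
      rw [horient _ _ (union_union_inter_eq_univ s₁ s₂) (by linarith)]
      intro hB
      refine hcover _ t₁ _ t₂ _ hB ?_
      exact union_union_inter_eq_univ s₁ s₂
    exact hcover _ hU _ t₃ _ hZ (union_compl _)

end BipSep
end

section
/- If S contains both r ∧ s and r ∨ s whenever r, s ∈ S, then for every integer k the set S_{k,‖·‖} := {s ∈ S : ‖s‖ < k} is structurally submodular: for all r, s ∈ S_{k,‖·‖}, at least one of r ∧ s and r ∨ s lies in S_{k,‖·‖}. -/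
open Finset

/-- The norm `‖s‖ := √(|V| − |A ∩ B|)` of a separation `s = (A,B)` of a finite set `V`. -/
noncomputable def sepNorm {V : Type*} [Fintype V] [DecidableEq V]
    (s : Finset V × Finset V) : ℝ :=
  Real.sqrt ((Fintype.card V : ℝ) - ((s.1 ∩ s.2).card : ℝ))

/-- The supremum `r ∨ s := (A₁ ∪ A₂, B₁ ∩ B₂)` of two separations. -/
def sepSup {V : Type*} [Fintype V] [DecidableEq V]
    (r s : Finset V × Finset V) : Finset V × Finset V :=
  (r.1 ∪ s.1, r.2 ∩ s.2)

/-- The infimum `r ∧ s := (A₁ ∩ A₂, B₁ ∪ B₂)` of two separations. -/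
def sepInf {V : Type*} [Fintype V] [DecidableEq V]
    (r s : Finset V × Finset V) : Finset V × Finset V :=
  (r.1 ∩ s.1, r.2 ∪ s.2)

theorem sepNorm_sq_add_card {V : Type*} [Fintype V] [DecidableEq V]
    {s : Finset V × Finset V} (hs : s.1 ∪ s.2 = univ) :
    sepNorm s ^ 2 + (s.1.card + s.2.card : ℝ) = 2 * Fintype.card V := by
  have hle : ((s.1 ∩ s.2).card : ℝ) ≤ Fintype.card V := by
    exact_mod_cast card_le_univ _
  have hcard : (Fintype.card V + (s.1 ∩ s.2).card : ℝ) = s.1.card + s.2.card := by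
    have h := card_union_add_card_inter s.1 s.2
    rw [hs, card_univ] at h
    exact_mod_cast h
  rw [sepNorm, Real.sq_sqrt (sub_nonneg.2 hle)]
  linarith

/-- The squared norm is modular on separations. -/
theorem sepNorm_sq_sepInf_add_sepNorm_sq_sepSup {V : Type*} [Fintype V] [DecidableEq V]
    {r s : Finset V × Finset V} (hr : r.1 ∪ r.2 = univ) (hs : s.1 ∪ s.2 = univ)
    (hinf : (sepInf r s).1 ∪ (sepInf r s).2 = univ)
    (hsup : (sepSup r s).1 ∪ (sepSup r s).2 = univ) :
    sepNorm (sepInf r s) ^ 2 + sepNorm (sepSup r s) ^ 2 = sepNorm r ^ 2 + sepNorm s ^ 2 := by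
  have h₁ : ((r.1 ∪ s.1).card + (r.1 ∩ s.1).card : ℝ) = r.1.card + s.1.card := by
    exact_mod_cast card_union_add_card_inter r.1 s.1
  have h₂ : ((r.2 ∪ s.2).card + (r.2 ∩ s.2).card : ℝ) = r.2.card + s.2.card := by
    exact_mod_cast card_union_add_card_inter r.2 s.2
  have hi : sepNorm (sepInf r s) ^ 2 + ((r.1 ∩ s.1).card + (r.2 ∪ s.2).card : ℝ)
      = 2 * Fintype.card V := sepNorm_sq_add_card hinf
  have hu : sepNorm (sepSup r s) ^ 2 + ((r.1 ∪ s.1).card + (r.2 ∩ s.2).card : ℝ)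
      = 2 * Fintype.card V := sepNorm_sq_add_card hsup
  linarith [sepNorm_sq_add_card hr, sepNorm_sq_add_card hs]

/-- If `S` is a set of separations of a finite set `V` closed under infima and suprema,
then for every integer `k` the set `S_{k,‖·‖} = {s ∈ S : ‖s‖ < k}` is structurally
submodular: for any two of its elements it contains their infimum or their supremum. -/
theorem norm_structurally_submodular {V : Type*} [Fintype V] [DecidableEq V]
    (S : Set (Finset V × Finset V))
    (hsep : ∀ p ∈ S, p.1 ∪ p.2 = univ)
    (hinf : ∀ r ∈ S, ∀ s ∈ S, sepInf r s ∈ S)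
    (hsup : ∀ r ∈ S, ∀ s ∈ S, sepSup r s ∈ S)
    (k : ℤ) (r s : Finset V × Finset V)
    (hr : r ∈ S ∧ sepNorm r < k) (hs : s ∈ S ∧ sepNorm s < k) :
    (sepInf r s ∈ S ∧ sepNorm (sepInf r s) < k) ∨
      (sepSup r s ∈ S ∧ sepNorm (sepSup r s) < k) := by
  have hi := hinf r hr.1 s hs.1
  have hu := hsup r hr.1 s hs.1
  have hmod := sepNorm_sq_sepInf_add_sepNorm_sq_sepSup (hsep r hr.1) (hsep s hs.1)
    (hsep _ hi) (hsep _ hu)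
  by_contra! h
  have hi' := h.1 hi
  have hu' := h.2 hu
  have hr₀ : 0 ≤ sepNorm r := Real.sqrt_nonneg _
  have hs₀ : 0 ≤ sepNorm s := Real.sqrt_nonneg _
  have hk : (0 : ℝ) ≤ k := hr₀.trans hr.2.le
  linarith [pow_lt_pow_left₀ hr.2 hr₀ two_ne_zero, pow_lt_pow_left₀ hs.2 hs₀ two_ne_zero,
    pow_le_pow_left₀ hk hi' 2, pow_le_pow_left₀ hk hu' 2]
end
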